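/- For every natural number n, in Polynomial ℚ with variable u, the polynomials defined by A_0 = u and A_n = u·A_{n−1}' + u^2·A_{n−1} satisfy A_n = Σ_{k=0}^{n} T(n,k)·u^{2k+1}, where T(n,k) is the number of B_n type set partitions with exactly k block pairs. -/

import Mathlib

open Finset Polynomial

attribute [local instance] Classical.propDecidable

/-- The negation `−β` of a block `β ⊆ ℤ`. -/
def negBlock (β : Finset ℤ) : Finset ℤ := β.image (fun x => -x)

/-- `π` is a `Bₙ`-type set partition of `{−n, …, n}`: blocks come in pairs `β, −β`, and exactly
one block (the zero block) is symmetric. -/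
def IsBType {n : ℕ} (π : Finpartition (Finset.Icc (-(n : ℤ)) (n : ℤ))) : Prop :=
  (∀ β ∈ π.parts, negBlock β ∈ π.parts) ∧
  (π.parts.filter (fun β => negBlock β = β)).card = 1

/-- `T n k`: the number of `Bₙ`-type set partitions with exactly `k` block pairs
(i.e. with `2k+1` blocks in total). -/
noncomputable def Tb (n k : ℕ) : ℕ :=
  (univ.filter (fun π : Finpartition (Finset.Icc (-(n : ℤ)) (n : ℤ)) =>
    IsBType π ∧ π.parts.card = 2 * k + 1)).card

structure BP (S : Finset ℤ) (P : Finset (Finset ℤ)) : Prop where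
  sub : ∀ β ∈ P, β ⊆ S
  ne : ∀ β ∈ P, β.Nonempty
  cov : ∀ x ∈ S, ∃ β ∈ P, x ∈ β
  dis : ∀ β ∈ P, ∀ γ ∈ P, ∀ x, x ∈ β → x ∈ γ → β = γ
  neg : ∀ β ∈ P, negBlock β ∈ P
  zero : ∀ β ∈ P, negBlock β = β → (0 : ℤ) ∈ β

noncomputable def Bset (S : Finset ℤ) : Finset (Finset (Finset ℤ)) :=
  S.powerset.powerset.filter (BP S)

lemma mem_Bset {S : Finset ℤ} {P : Finset (Finset ℤ)} : P ∈ Bset S ↔ BP S P := by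
  unfold Bset
  simp only [mem_filter, mem_powerset, and_iff_right_iff_imp]
  intro h β hβ
  exact mem_powerset.2 (h.sub β hβ)

lemma mem_negBlock {β : Finset ℤ} {x : ℤ} : x ∈ negBlock β ↔ -x ∈ β := by
  unfold negBlock
  simp only [mem_image]
  constructor
  · rintro ⟨y, hy, rfl⟩; simpa using hy
  · intro h; exact ⟨-x, h, by simp⟩

lemma negBlock_negBlock (β : Finset ℤ) : negBlock (negBlock β) = β := by
  ext x; simp [mem_negBlock]

lemma negBlock_inj {β γ : Finset ℤ} : negBlock β = negBlock γ ↔ β = γ := by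
  constructor
  · intro h; rw [← negBlock_negBlock β, h, negBlock_negBlock]
  · rintro rfl; rfl

lemma negBlock_eq_iff {β γ : Finset ℤ} : negBlock β = γ ↔ β = negBlock γ := by
  rw [← negBlock_inj, negBlock_negBlock]

noncomputable def extB (a : ℤ) (β γ : Finset ℤ) : Finset ℤ :=
  γ ∪ (if γ = β then {a} else ∅) ∪ (if γ = negBlock β then {-a} else ∅)

lemma mem_extB {a : ℤ} {β γ : Finset ℤ} {x : ℤ} :
    x ∈ extB a β γ ↔ x ∈ γ ∨ (γ = β ∧ x = a) ∨ (γ = negBlock β ∧ x = -a) := by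
  unfold extB
  by_cases h1 : γ = β <;> by_cases h2 : γ = negBlock β <;> simp [h1, h2]
  all_goals grind

lemma negBlock_extB (a : ℤ) (β γ : Finset ℤ) :
    negBlock (extB a β γ) = extB a β (negBlock γ) := by
  ext x
  rw [mem_negBlock, mem_extB, mem_extB, mem_negBlock, negBlock_inj, negBlock_eq_iff]
  have h1 : -x = a ↔ x = -a := by omega
  have h2 : -x = -a ↔ x = a := by omega
  rw [h1, h2]; tauto

structure Good (S : Finset ℤ) (a : ℤ) : Prop where
  neg : ∀ x ∈ S, -x ∈ S
  zero : (0 : ℤ) ∈ S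
  na : a ∉ S

def addS (S : Finset ℤ) (a : ℤ) : Finset ℤ := insert a (insert (-a) S)

lemma mem_addS {S : Finset ℤ} {a x : ℤ} : x ∈ addS S a ↔ x = a ∨ x = -a ∨ x ∈ S := by
  simp [addS]

section
variable {S : Finset ℤ} {a : ℤ}

lemma Good.nna (g : Good S a) : -a ∉ S := fun h => g.na (by simpa using g.neg _ h)

lemma Good.a0 (g : Good S a) : a ≠ 0 := fun h => g.na (h ▸ g.zero)

lemma extB_inter (g : Good S a) {β γ : Finset ℤ} (h : γ ⊆ S) : extB a β γ ∩ S = γ := by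
  ext x
  rw [mem_inter, mem_extB]
  have := g.na
  have := g.nna
  have := @h x
  constructor
  · rintro ⟨h1 | ⟨_, rfl⟩ | ⟨_, rfl⟩, h2⟩ <;> tauto
  · tauto

lemma negBlock_inter (g : Good S a) (β : Finset ℤ) : negBlock (β ∩ S) = negBlock β ∩ S := by
  ext x
  simp only [mem_negBlock, mem_inter]
  have h1 := g.neg x
  have h2 := g.neg (-x)
  rw [neg_neg] at h2
  tauto

/-- extension by attaching to a block -/
lemma BP.ext1 (g : Good S a) {P : Finset (Finset ℤ)} (h : BP S P) {β : Finset ℤ} (hβ : β ∈ P) :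
    BP (addS S a) (P.image (extB a β)) where
  sub := by
    simp only [mem_image]
    rintro _ ⟨γ, hγ, rfl⟩ x hx
    have := fun (hh : x ∈ γ) => h.sub γ hγ hh
    rw [mem_extB] at hx
    rw [mem_addS]
    tauto
  ne := by
    simp only [mem_image]
    rintro _ ⟨γ, hγ, rfl⟩
    obtain ⟨x, hx⟩ := h.ne γ hγ
    exact ⟨x, mem_extB.2 (Or.inl hx)⟩
  cov := by
    intro x hx
    simp only [mem_image, exists_exists_and_eq_and]
    simp only [mem_extB]
    rcases mem_addS.1 hx with rfl | rfl | hx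
    · exact ⟨β, hβ, by tauto⟩
    · exact ⟨negBlock β, h.neg β hβ, by tauto⟩
    · obtain ⟨γ, h1, h2⟩ := h.cov x hx
      exact ⟨γ, h1, Or.inl h2⟩
  dis := by
    simp only [mem_image]
    rintro _ ⟨γ, hγ, rfl⟩ _ ⟨δ, hδ, rfl⟩ x hx hy
    congr 1
    rw [mem_extB] at hx hy
    have h1 := h.dis γ hγ δ hδ x
    have h2 := fun (hh : x ∈ γ) => h.sub γ hγ hh
    have h3 := fun (hh : x ∈ δ) => h.sub δ hδ hh
    have h4 := g.na
    have h5 := g.nna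
    have h6 := g.a0
    have h7 : x = a → x = -a → False := by omega
    rcases hx with hx | ⟨hx, rfl⟩ | ⟨hx, rfl⟩ <;> rcases hy with hy | ⟨hy, hy'⟩ | ⟨hy, hy'⟩ <;>
      grind
  neg := by
    simp only [mem_image]
    rintro _ ⟨γ, hγ, rfl⟩
    exact ⟨negBlock γ, h.neg γ hγ, (negBlock_extB a β γ).symm⟩
  zero := by
    simp only [mem_image]
    rintro _ ⟨γ, hγ, rfl⟩ hh
    rw [negBlock_extB] at hh
    rw [mem_extB]
    left
    apply h.zero γ hγ
    rw [← extB_inter g (β := β) (h.sub _ (h.neg γ hγ)), hh, extB_inter g (h.sub γ hγ)]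

lemma ext1_res (g : Good S a) {P : Finset (Finset ℤ)} (h : BP S P) (β : Finset ℤ) :
    (P.image (extB a β)).image (· ∩ S) = P := by
  rw [image_image]
  conv_rhs => rw [← image_id (s := P)]
  apply image_congr
  intro γ hγ
  exact extB_inter g (h.sub γ hγ)

lemma ext1_card (g : Good S a) {P : Finset (Finset ℤ)} (h : BP S P) (β : Finset ℤ) :
    (P.image (extB a β)).card = P.card := by
  apply card_image_of_injOn
  intro γ hγ δ hδ e
  rw [← extB_inter g (β := β) (h.sub _ hγ), ← extB_inter g (β := β) (h.sub _ hδ)]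
  exact congrArg (· ∩ S) e

lemma ext1_not (g : Good S a) {P : Finset (Finset ℤ)} (h : BP S P) (β : Finset ℤ) :
    {a} ∉ P.image (extB a β) := by
  simp only [mem_image, not_exists, not_and]
  intro γ hγ e
  obtain ⟨x, hx⟩ := h.ne γ hγ
  have : x ∈ extB a β γ := mem_extB.2 (Or.inl hx)
  rw [e, mem_singleton] at this
  exact g.na (this ▸ h.sub γ hγ hx)

lemma ext1_inj (g : Good S a) {P Q : Finset (Finset ℤ)} (h : BP S P) (h' : BP S Q)
    {β γ : Finset ℤ} (hβ : β ∈ P) (hγ : γ ∈ Q) (e : P.image (extB a β) = Q.image (extB a γ)) :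
    P = Q ∧ β = γ := by
  have e1 : P = Q := by rw [← ext1_res g h β, e, ext1_res g h' γ]
  refine ⟨e1, ?_⟩
  have h1 : extB a β β ∈ P.image (extB a β) := mem_image_of_mem _ hβ
  have h2 : extB a γ γ ∈ P.image (extB a β) := e ▸ mem_image_of_mem _ hγ
  have := (h.ext1 g hβ).dis _ h1 _ h2 a (mem_extB.2 (by tauto)) (mem_extB.2 (by tauto))
  rw [← extB_inter g (β := β) (h.sub _ hβ), this, extB_inter g (h'.sub _ hγ)]

lemma BP.inter_nonempty (g : Good S a) {Q : Finset (Finset ℤ)} (h : BP (addS S a) Q)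
    (hn : {a} ∉ Q) {γ : Finset ℤ} (hγ : γ ∈ Q) : (γ ∩ S).Nonempty := by
  by_contra hc
  rw [not_nonempty_iff_eq_empty] at hc
  have hS : ∀ x ∈ γ, x ∉ S := fun x hx hxS => by
    have : x ∈ γ ∩ S := mem_inter.2 ⟨hx, hxS⟩
    rw [hc] at this; simp at this
  have hx2 : ∀ x ∈ γ, x = a ∨ x = -a := fun x hx => by
    have := mem_addS.1 (h.sub γ hγ hx)
    have := hS x hx
    tauto
  have h0 : (0 : ℤ) ∉ γ := fun h0 => hS 0 h0 g.zero
  obtain ⟨x, hx⟩ := h.ne γ hγ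
  by_cases ha : a ∈ γ <;> by_cases hb : -a ∈ γ
  · apply h0
    apply h.zero γ hγ
    exact h.dis _ (h.neg γ hγ) _ hγ a (mem_negBlock.2 hb) ha
  · apply hn
    convert hγ
    ext y
    rw [mem_singleton]
    have := hx2 y
    constructor
    · rintro rfl; exact ha
    · intro hy
      rcases this hy with h | h
      · exact h
      · subst h; exact absurd hy hb
  · apply hn
    convert h.neg γ hγ
    ext y
    rw [mem_singleton, mem_negBlock]
    have := hx2 (-y)
    constructor
    · rintro rfl; exact hb
    · intro hy
      rcases this hy with h | h
      · rw [h] at hy; exact absurd hy ha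
      · omega
  · rcases hx2 x hx with rfl | rfl <;> tauto

lemma ext1_surj (g : Good S a) {Q : Finset (Finset ℤ)} (h : BP (addS S a) Q) (hn : {a} ∉ Q) :
    ∃ P β, BP S P ∧ β ∈ P ∧ P.image (extB a β) = Q := by
  obtain ⟨b, hb, hab⟩ := h.cov a (mem_addS.2 (Or.inl rfl))
  have inj : ∀ γ ∈ Q, ∀ δ ∈ Q, γ ∩ S = δ ∩ S → γ = δ := by
    intro γ hγ δ hδ e
    obtain ⟨x, hx⟩ := h.inter_nonempty g hn hγ
    have hx' := hx
    rw [e] at hx'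
    exact h.dis γ hγ δ hδ x (mem_inter.1 hx).1 (mem_inter.1 hx').1
  refine ⟨Q.image (· ∩ S), b ∩ S, ?_, mem_image_of_mem _ hb, ?_⟩
  · constructor
    · simp only [mem_image]
      rintro _ ⟨γ, hγ, rfl⟩
      exact inter_subset_right
    · simp only [mem_image]
      rintro _ ⟨γ, hγ, rfl⟩
      exact h.inter_nonempty g hn hγ
    · intro x hx
      obtain ⟨γ, hγ, hxγ⟩ := h.cov x (mem_addS.2 (by tauto))
      exact ⟨γ ∩ S, mem_image_of_mem _ hγ, mem_inter.2 ⟨hxγ, hx⟩⟩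
    · simp only [mem_image]
      rintro _ ⟨γ, hγ, rfl⟩ _ ⟨δ, hδ, rfl⟩ x hx hy
      rw [h.dis γ hγ δ hδ x (mem_inter.1 hx).1 (mem_inter.1 hy).1]
    · simp only [mem_image]
      rintro _ ⟨γ, hγ, rfl⟩
      exact ⟨negBlock γ, h.neg γ hγ, (negBlock_inter g γ).symm⟩
    · simp only [mem_image]
      rintro _ ⟨γ, hγ, rfl⟩ e
      rw [negBlock_inter g] at e
      exact mem_inter.2 ⟨h.zero γ hγ (inj _ (h.neg γ hγ) _ hγ e), g.zero⟩
  · rw [image_image]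
    conv_rhs => rw [← image_id (s := Q)]
    apply image_congr
    intro γ hγ
    have hγ : γ ∈ Q := hγ
    ext x
    simp only [Function.comp, id, mem_extB, mem_inter]
    rw [negBlock_inter g]
    have e1 : γ ∩ S = b ∩ S ↔ a ∈ γ := by
      constructor
      · intro e; rw [inj _ hγ _ hb e]; exact hab
      · intro e; rw [h.dis _ hγ _ hb a e hab]
    have e2 : γ ∩ S = negBlock b ∩ S ↔ -a ∈ γ := by
      have hab' : -a ∈ negBlock b := by simpa [mem_negBlock] using hab
      constructor
      · intro e; rw [inj _ hγ _ (h.neg b hb) e]; exact hab'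
      · intro e; rw [h.dis _ hγ _ (h.neg b hb) (-a) e hab']
    rw [e1, e2]
    constructor
    · rintro (⟨h, _⟩ | ⟨h, rfl⟩ | ⟨h, rfl⟩) <;> exact h
    · intro hx
      rcases mem_addS.1 (h.sub γ hγ hx) with rfl | rfl | h' <;> tauto

/-- extension by new singletons -/
def ext2 (a : ℤ) (P : Finset (Finset ℤ)) : Finset (Finset ℤ) := insert {a} (insert {-a} P)

lemma mem_ext2 {P : Finset (Finset ℤ)} {γ : Finset ℤ} :
    γ ∈ ext2 a P ↔ γ = {a} ∨ γ = {-a} ∨ γ ∈ P := by simp [ext2]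

lemma negBlock_singleton (x : ℤ) : negBlock {x} = {-x} := by simp [negBlock]

lemma BP.a_not (g : Good S a) {P : Finset (Finset ℤ)} (h : BP S P) : {a} ∉ P := fun hh =>
  g.na (h.sub _ hh (mem_singleton_self a))

lemma BP.na_not (g : Good S a) {P : Finset (Finset ℤ)} (h : BP S P) : {-a} ∉ P := fun hh =>
  g.nna (h.sub _ hh (mem_singleton_self _))

lemma Good.sne (g : Good S a) : ({a} : Finset ℤ) ≠ {-a} := by
  have := g.a0
  intro h
  rw [singleton_inj] at h
  omega

lemma ext2_card (g : Good S a) {P : Finset (Finset ℤ)} (h : BP S P) :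
    (ext2 a P).card = P.card + 2 := by
  unfold ext2
  rw [card_insert_of_notMem, card_insert_of_notMem (h.na_not g)]
  rw [mem_insert, not_or]
  exact ⟨g.sne, h.a_not g⟩

lemma BP.ext2 (g : Good S a) {P : Finset (Finset ℤ)} (h : BP S P) :
    BP (addS S a) (ext2 a P) where
  sub := by
    intro γ hγ x hx
    rw [mem_addS]
    rcases mem_ext2.1 hγ with rfl | rfl | hγ
    · rw [mem_singleton] at hx; tauto
    · rw [mem_singleton] at hx; tauto
    · have := h.sub γ hγ hx; tauto
  ne := by
    intro γ hγ
    rcases mem_ext2.1 hγ with rfl | rfl | hγ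
    · simp
    · simp
    · exact h.ne γ hγ
  cov := by
    intro x hx
    rcases mem_addS.1 hx with rfl | rfl | hx
    · exact ⟨{x}, mem_ext2.2 (by tauto), by simp⟩
    · exact ⟨{-a}, mem_ext2.2 (by tauto), by simp⟩
    · obtain ⟨β, h1, h2⟩ := h.cov x hx
      exact ⟨β, mem_ext2.2 (by tauto), h2⟩
  dis := by
    intro γ hγ δ hδ x hx hy
    have h1 := g.na
    have h2 := g.nna
    have h3 := g.a0
    rcases mem_ext2.1 hγ with rfl | rfl | hγ' <;> rcases mem_ext2.1 hδ with rfl | rfl | hδ'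
    · rfl
    · simp only [mem_singleton] at hx hy; omega
    · rw [mem_singleton] at hx; subst hx; exact absurd (h.sub _ hδ' hy) h1
    · simp only [mem_singleton] at hx hy; omega
    · rfl
    · rw [mem_singleton] at hx; subst hx; exact absurd (h.sub _ hδ' hy) h2
    · rw [mem_singleton] at hy; subst hy; exact absurd (h.sub _ hγ' hx) h1
    · rw [mem_singleton] at hy; subst hy; exact absurd (h.sub _ hγ' hx) h2
    · exact h.dis γ hγ' δ hδ' x hx hy
  neg := by
    intro γ hγ
    rw [mem_ext2]
    rcases mem_ext2.1 hγ with rfl | rfl | hγ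
    · rw [negBlock_singleton]; tauto
    · rw [negBlock_singleton, neg_neg]; tauto
    · have := h.neg γ hγ; tauto
  zero := by
    intro γ hγ e
    rcases mem_ext2.1 hγ with rfl | rfl | hγ
    · rw [negBlock_singleton] at e; exact absurd e.symm g.sne
    · rw [negBlock_singleton, neg_neg] at e; exact absurd e g.sne
    · exact h.zero γ hγ e

lemma ext2_res (g : Good S a) {P : Finset (Finset ℤ)} (h : BP S P) :
    ((ext2 a P).erase {a}).erase {-a} = P := by
  ext γ
  have h1 := h.a_not g
  have h2 := h.na_not g
  simp only [mem_erase, mem_ext2]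
  constructor
  · tauto
  · intro hγ
    refine ⟨?_, ?_, by tauto⟩
    · rintro rfl; exact h2 hγ
    · rintro rfl; exact h1 hγ

lemma ext2_surj (g : Good S a) {Q : Finset (Finset ℤ)} (h : BP (addS S a) Q) (hn : {a} ∈ Q) :
    ∃ P, BP S P ∧ ext2 a P = Q := by
  have hn' : {-a} ∈ Q := by have := h.neg _ hn; rwa [negBlock_singleton] at this
  have key : ∀ γ, γ ∈ (Q.erase {a}).erase {-a} ↔ γ ≠ {-a} ∧ γ ≠ {a} ∧ γ ∈ Q := by
    intro γ; simp only [mem_erase]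
  refine ⟨(Q.erase {a}).erase {-a}, ⟨?_, ?_, ?_, ?_, ?_, ?_⟩, ?_⟩
  · intro γ hγ x hx
    obtain ⟨h1, h2, h3⟩ := (key γ).1 hγ
    rcases mem_addS.1 (h.sub γ h3 hx) with rfl | rfl | hS
    · exact absurd (h.dis _ h3 _ hn _ hx (by simp)) h2
    · exact absurd (h.dis _ h3 _ hn' _ hx (by simp)) h1
    · exact hS
  · intro γ hγ
    exact h.ne γ ((key γ).1 hγ).2.2
  · intro x hx
    obtain ⟨γ, hγ, hxγ⟩ := h.cov x (mem_addS.2 (by tauto))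
    refine ⟨γ, (key γ).2 ⟨?_, ?_, hγ⟩, hxγ⟩
    · rintro rfl; rw [mem_singleton] at hxγ; exact g.nna (hxγ ▸ hx)
    · rintro rfl; rw [mem_singleton] at hxγ; exact g.na (hxγ ▸ hx)
  · intro γ hγ δ hδ
    exact h.dis γ ((key γ).1 hγ).2.2 δ ((key δ).1 hδ).2.2
  · intro γ hγ
    obtain ⟨h1, h2, h3⟩ := (key γ).1 hγ
    refine (key _).2 ⟨?_, ?_, h.neg γ h3⟩
    · rw [Ne, negBlock_eq_iff, negBlock_singleton, neg_neg]; exact h2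
    · rw [Ne, negBlock_eq_iff, negBlock_singleton]; exact h1
  · intro γ hγ
    exact h.zero γ ((key γ).1 hγ).2.2
  · ext γ
    rw [mem_ext2, key]
    constructor
    · rintro (rfl | rfl | h) <;> tauto
    · tauto

noncomputable def GG (S : Finset ℤ) : Polynomial ℚ := ∑ P ∈ Bset S, X ^ P.card

lemma GG_addS (g : Good S a) :
    GG (addS S a) = X * derivative (GG S) + X ^ 2 * GG S := by
  unfold GG
  rw [← sum_filter_add_sum_filter_not (Bset (addS S a)) (fun Q => {a} ∉ Q)]
  congr 1
  · have : X * derivative (∑ P ∈ Bset S, (X : Polynomial ℚ) ^ P.card)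
        = ∑ z ∈ (Bset S).sigma (fun P => P), X ^ z.1.card := by
      rw [sum_sigma, derivative_sum, mul_sum]
      apply sum_congr rfl
      intro P hP
      simp only []
      rw [sum_const, derivative_X_pow, nsmul_eq_mul]
      rcases h : P.card with _ | m
      · simp
      · simp only [add_tsub_cancel_right, map_natCast]; ring
    rw [this]
    symm
    apply sum_bij (fun z _ => z.1.image (extB a z.2))
    · rintro ⟨P, β⟩ hz
      simp only [mem_sigma, mem_Bset] at hz
      simp only [mem_filter, mem_Bset]
      exact ⟨hz.1.ext1 g hz.2, ext1_not g hz.1 β⟩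
    · rintro ⟨P, β⟩ hz ⟨P', β'⟩ hz' e
      simp only [mem_sigma, mem_Bset] at hz hz'
      obtain ⟨rfl, rfl⟩ := ext1_inj g hz.1 hz'.1 hz.2 hz'.2 e
      rfl
    · intro Q hQ
      simp only [mem_filter, mem_Bset] at hQ
      obtain ⟨P, β, h1, h2, h3⟩ := ext1_surj g hQ.1 hQ.2
      exact ⟨⟨P, β⟩, by simp only [mem_sigma, mem_Bset]; exact ⟨h1, h2⟩, h3⟩
    · rintro ⟨P, β⟩ hz
      simp only [mem_sigma, mem_Bset] at hz
      simp only [ext1_card g hz.1 β]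
  · rw [mul_sum]
    symm
    apply sum_bij (fun P _ => ext2 a P)
    · intro P hP
      rw [mem_Bset] at hP
      simp only [mem_filter, mem_Bset, not_not]
      exact ⟨hP.ext2 g, mem_ext2.2 (Or.inl rfl)⟩
    · intro P hP P' hP' e
      rw [mem_Bset] at hP hP'
      rw [← ext2_res g hP, e, ext2_res g hP']
    · intro Q hQ
      simp only [mem_filter, mem_Bset, not_not] at hQ
      obtain ⟨P, h1, h2⟩ := ext2_surj g hQ.1 hQ.2
      exact ⟨P, mem_Bset.2 h1, h2⟩
    · intro P hP
      rw [mem_Bset] at hP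
      rw [ext2_card g hP]; ring

end

lemma good_Icc (n : ℕ) : Good (Icc (-(n : ℤ)) n) (n + 1) := by
  constructor
  · intro x hx; rw [mem_Icc] at *; omega
  · rw [mem_Icc]; omega
  · rw [mem_Icc]; omega

lemma Icc_succ_eq (n : ℕ) :
    Icc (-((n + 1 : ℕ) : ℤ)) ((n + 1 : ℕ) : ℤ) = addS (Icc (-(n : ℤ)) n) (n + 1) := by
  ext x
  rw [mem_addS, mem_Icc, mem_Icc]; push_cast; omega

lemma BP_zero_iff {P : Finset (Finset ℤ)} : BP {0} P ↔ P = {{0}} := by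
  constructor
  · intro h
    have hb : ∀ β ∈ P, β = {0} := by
      intro β hβ
      exact (h.ne β hβ).subset_singleton_iff.1 (h.sub β hβ)
    obtain ⟨β, h1, _⟩ := h.cov 0 (by simp)
    ext γ
    rw [mem_singleton]
    constructor
    · exact hb γ
    · rintro rfl; exact hb β h1 ▸ h1
  · rintro rfl
    constructor <;> simp [negBlock]

lemma card_shape (n : ℕ) : ∀ P, BP (Icc (-(n : ℤ)) n) P → ∃ k, k < n + 1 ∧ P.card = 2 * k + 1 := by
  induction n with
  | zero =>
    intro P hP
    have : Icc (-((0 : ℕ) : ℤ)) ((0 : ℕ) : ℤ) = {0} := by simp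
    rw [this, BP_zero_iff] at hP
    exact ⟨0, by omega, by simp [hP]⟩
  | succ n ih =>
    intro Q hQ
    rw [Icc_succ_eq] at hQ
    have g := good_Icc n
    by_cases h : {(n : ℤ) + 1} ∈ Q
    · obtain ⟨P, h1, rfl⟩ := ext2_surj g hQ h
      obtain ⟨k, hk, hc⟩ := ih P h1
      exact ⟨k + 1, by omega, by rw [ext2_card g h1]; omega⟩
    · obtain ⟨P, β, h1, h2, rfl⟩ := ext1_surj g hQ h
      obtain ⟨k, hk, hc⟩ := ih P h1
      exact ⟨k, by omega, by rw [ext1_card g h1]; omega⟩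

lemma BP_iff {n : ℕ} (π : Finpartition (Icc (-(n : ℤ)) (n : ℤ))) :
    BP (Icc (-(n : ℤ)) n) π.parts ↔ IsBType π := by
  have h0 : (0 : ℤ) ∈ Icc (-(n : ℤ)) n := (good_Icc n).zero
  obtain ⟨b, hb, hb0⟩ := π.exists_mem h0
  have dis : ∀ β ∈ π.parts, ∀ γ ∈ π.parts, ∀ x, x ∈ β → x ∈ γ → β = γ :=
    fun β hβ γ hγ x h1 h2 => π.eq_of_mem_parts hβ hγ h1 h2
  constructor
  · intro h
    refine ⟨h.neg, ?_⟩
    rw [card_eq_one]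
    refine ⟨b, ?_⟩
    ext γ
    rw [mem_filter, mem_singleton]
    constructor
    · rintro ⟨h1, h2⟩
      exact dis _ h1 _ hb 0 (h.zero _ h1 h2) hb0
    · rintro rfl
      exact ⟨hb, dis _ (h.neg _ hb) _ hb 0 (by simpa [mem_negBlock] using hb0) hb0⟩
  · rintro ⟨h1, h2⟩
    refine ⟨fun β hβ => π.le hβ, fun β hβ => π.nonempty_of_mem_parts hβ,
      fun x hx => π.exists_mem hx, dis, h1, ?_⟩
    intro β hβ e
    obtain ⟨c, hc⟩ := card_eq_one.1 h2
    have m1 : β ∈ π.parts.filter (fun β => negBlock β = β) := mem_filter.2 ⟨hβ, e⟩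
    have m2 : b ∈ π.parts.filter (fun β => negBlock β = β) := mem_filter.2
      ⟨hb, dis _ (h1 _ hb) _ hb 0 (by simpa [mem_negBlock] using hb0) hb0⟩
    rw [hc, mem_singleton] at m1 m2
    rw [m1, ← m2]; exact hb0

lemma Tb_eq (n k : ℕ) :
    Tb n k = ((Bset (Icc (-(n : ℤ)) n)).filter (fun P => P.card = 2 * k + 1)).card := by
  unfold Tb
  apply card_bij (fun π _ => π.parts)
  · intro π hπ
    simp only [mem_filter, mem_univ, true_and] at hπ
    simp only [mem_filter, mem_Bset]
    exact ⟨(BP_iff π).2 hπ.1, hπ.2⟩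
  · intro π _ π' _ e
    exact Finpartition.ext e
  · intro P hP
    simp only [mem_filter, mem_Bset] at hP
    obtain ⟨h, hc⟩ := hP
    let π : Finpartition (Icc (-(n : ℤ)) (n : ℤ)) :=
      { parts := P
        supIndep := by
          rw [Finset.supIndep_iff_pairwiseDisjoint]
          intro β hβ γ hγ hne
          rw [Function.onFun, id, id, Finset.disjoint_left]
          intro x h1 h2
          exact hne (h.dis β hβ γ hγ x h1 h2)
        sup_parts := by
          ext x
          rw [Finset.mem_sup]
          constructor
          · rintro ⟨β, hβ, hx⟩; exact h.sub β hβ hx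
          · intro hx; exact h.cov x hx
        bot_notMem := by
          intro hb
          exact Finset.not_nonempty_empty (h.ne _ hb) }
    refine ⟨π, ?_, rfl⟩
    simp only [mem_filter, mem_univ, true_and]
    exact ⟨(BP_iff π).1 h, hc⟩

lemma GG_Icc (n : ℕ) :
    GG (Icc (-(n : ℤ)) n) = ∑ k ∈ range (n + 1), C ((Tb n k : ℚ)) * X ^ (2 * k + 1) := by
  unfold GG
  rw [← sum_fiberwise_of_maps_to (s := Bset (Icc (-(n : ℤ)) n)) (t := range (n + 1))
    (g := fun P => P.card / 2)]
  · apply sum_congr rfl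
    intro k hk
    rw [Tb_eq]
    have : (Bset (Icc (-(n : ℤ)) n)).filter (fun P => P.card / 2 = k) =
        (Bset (Icc (-(n : ℤ)) n)).filter (fun P => P.card = 2 * k + 1) := by
      apply filter_congr
      intro P hP
      obtain ⟨j, _, hj⟩ := card_shape n P (mem_Bset.1 hP)
      omega
    rw [this, sum_congr rfl (g := fun _ => (X : Polynomial ℚ) ^ (2 * k + 1))]
    · rw [sum_const, nsmul_eq_mul, map_natCast]
    · intro P hP
      rw [(mem_filter.1 hP).2]
  · intro P hP
    obtain ⟨j, _, hj⟩ := card_shape n P (mem_Bset.1 hP)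
    rw [mem_range]; omega

/-- The polynomials `A 0 = u`, `A n = u·(A (n−1))' + u²·(A (n−1))` satisfy
`A n = Σ_{k=0}^{n} T(n,k)·u^{2k+1}`, where `T(n,k)` counts `Bₙ`-type set partitions with
exactly `k` block pairs. -/
theorem B_bell_polynomial_eq_sum
    (A : ℕ → Polynomial ℚ)
    (hA0 : A 0 = X)
    (hA : ∀ m, A (m + 1) = X * derivative (A m) + X ^ 2 * A m)
    (n : ℕ) :
    A n = ∑ k ∈ range (n + 1), C ((Tb n k : ℚ)) * X ^ (2 * k + 1) := by
  rw [← GG_Icc]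
  induction n with
  | zero =>
    have h : Icc (-((0 : ℕ) : ℤ)) ((0 : ℕ) : ℤ) = {0} := by simp
    have h2 : Bset {0} = {{{0}}} := by
      ext P; rw [mem_Bset, BP_zero_iff, mem_singleton]
    rw [hA0, h, GG, h2]; simp
  | succ n ih => rw [hA, ih, Icc_succ_eq, GG_addS (good_Icc n)]
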